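/- arXiv:1603.08790 — 2 statements merged into one kernel-verified Lean document; each statement's English description precedes it below -/
import Mathlib

section
/- For any probability density F_N on ℝ^N, any 1 ≤ j ≤ N and any ξ ∈ ℝ^N, the Fourier transform of R_j[F_N] satisfies \widehat{R_j[F_N]}(ξ) = (1/(2π)) ∫₀^{2π} \widehat{F_N}(ξ_j(θ)) ĝ(ξ_j sin θ) dθ, where ξ_j(θ) is ξ with coordinate ξ_j replaced by ξ_j cos θ, and ĝ is the Fourier transform of g. -/
open MeasureTheory Real Finset

noncomputable section

/-- The state space of `N` one-dimensional velocities. -/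
abbrev V (N : ℕ) := Fin N → ℝ

/-- A probability density on `ℝ^N`. -/
def IsProbDensity {N : ℕ} (F : V N → ℝ) : Prop :=
  (∀ v, 0 ≤ F v) ∧ Integrable F ∧ ∫ v, F v = 1

/-- A probability density on `ℝ`. -/
def IsProbDensity1 (g : ℝ → ℝ) : Prop :=
  (∀ x, 0 ≤ g x) ∧ Integrable g ∧ ∫ x, g x = 1

/-- The velocity vector after the Kac collision of particles `i` and `j` with angle `θ`. -/
def collide {N : ℕ} (v : V N) (i j : Fin N) (θ : ℝ) : V N :=
  Function.update (Function.update v i (v i * Real.cos θ + v j * Real.sin θ)) j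
    (-(v i) * Real.sin θ + v j * Real.cos θ)

/-- Kac's collision operator `Q`. -/
def QOp {N : ℕ} (F : V N → ℝ) : V N → ℝ := fun v =>
  (N.choose 2 : ℝ)⁻¹ * ∑ i : Fin N, ∑ j : Fin N,
    if i < j then (2 * π)⁻¹ * ∫ θ in (0:ℝ)..(2 * π), F (collide v i j θ) else 0

/-- The thermostat operator `R_j` with reservoir distribution `g`. -/
def ROp {N : ℕ} (g : ℝ → ℝ) (j : Fin N) (F : V N → ℝ) : V N → ℝ := fun v =>
  ∫ w : ℝ, (2 * π)⁻¹ * ∫ θ in (0:ℝ)..(2 * π),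
    g (w * Real.cos θ - v j * Real.sin θ) *
      F (Function.update v j (v j * Real.cos θ + w * Real.sin θ))

/-- The fixed point operator `Φ = γ Q + (1-γ) (1/N) ∑ⱼ Rⱼ`. -/
def PhiOp {N : ℕ} (γ : ℝ) (g : ℝ → ℝ) (F : V N → ℝ) : V N → ℝ := fun v =>
  γ * QOp F v + (1 - γ) * (N : ℝ)⁻¹ * ∑ j : Fin N, ROp g j F v

/-- Fourier transform of a density on `ℝ^N`. -/
def ft {N : ℕ} (f : V N → ℝ) (ξ : V N) : ℂ :=
  ∫ v : V N, (f v : ℂ) * Complex.exp (-Complex.I * ((∑ i, v i * ξ i : ℝ) : ℂ))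

/-- Fourier transform of a density on `ℝ`. -/
def ft1 (f : ℝ → ℝ) (ξ : ℝ) : ℂ :=
  ∫ v : ℝ, (f v : ℂ) * Complex.exp (-Complex.I * ((v * ξ : ℝ) : ℂ))

/-- The Gabetta–Toscani–Wennberg distance on `ℝ^N`. -/
def dGTW {N : ℕ} (f h : V N → ℝ) : ℝ :=
  ⨆ ξ : {ξ : V N // ξ ≠ 0}, ‖ft f ξ.1 - ft h ξ.1‖ / (∑ i, (ξ.1 i) ^ 2)

/-- The `T1` distance on `ℝ^N`. -/
def dT1 {N : ℕ} (f h : V N → ℝ) : ℝ :=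
  ⨆ ξ : {ξ : V N // ξ ≠ 0}, ‖ft f ξ.1 - ft h ξ.1‖ / Real.sqrt (∑ i, (ξ.1 i) ^ 2)

/-- The Gabetta–Toscani–Wennberg distance on `ℝ`. -/
def dGTW1 (f h : ℝ → ℝ) : ℝ :=
  ⨆ ξ : {ξ : ℝ // ξ ≠ 0}, ‖ft1 f ξ.1 - ft1 h ξ.1‖ / (ξ.1) ^ 2

/-- The `T1` distance on `ℝ`. -/
def dT11 (f h : ℝ → ℝ) : ℝ :=
  ⨆ ξ : {ξ : ℝ // ξ ≠ 0}, ‖ft1 f ξ.1 - ft1 h ξ.1‖ / |ξ.1|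

/-- `F : ℝ → V N → ℝ` is a solution of the coupled Kac master equation
`∂ₜ F = -λN(I-Q)[F] - μ ∑ⱼ (I-Rⱼ)[F]`. -/
def IsSolution {N : ℕ} (lam mu : ℝ) (g : ℝ → ℝ) (F : ℝ → V N → ℝ) : Prop :=
  (∀ t, IsProbDensity (F t)) ∧
    ∀ t v, HasDerivAt (fun s => F s v)
      (-(lam * N) * (F t v - QOp (F t) v) - mu * ∑ j : Fin N, (F t v - ROp g j (F t) v)) t

/-- `N`-fold tensor power of a density on `ℝ`. -/
def tensorPow (f : ℝ → ℝ) (N : ℕ) : V N → ℝ := fun v => ∏ i, f (v i)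

/-- First marginal of a density on `ℝ^N`. -/
def marg1 {N : ℕ} (F : V N → ℝ) : ℝ → ℝ := fun x =>
  ∫ w : V (N - 1),
    F (fun i => if h : (i : ℕ) = 0 then x else w ⟨(i : ℕ) - 1, by have := i.isLt; omega⟩)

/-- The `k`-th marginal of a density on `ℝ^N`. -/
def marg {N : ℕ} (k : ℕ) (F : V N → ℝ) : V k → ℝ := fun u =>
  ∫ w : V (N - k),
    F (fun i => if h : (i : ℕ) < k then u ⟨(i : ℕ), h⟩
        else w ⟨(i : ℕ) - k, by have := i.isLt; omega⟩)

/-- A density symmetric under permutations of the variables. -/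
def IsSymmetric {N : ℕ} (F : V N → ℝ) : Prop :=
  ∀ σ : Equiv.Perm (Fin N), ∀ v : V N, F (v ∘ σ) = F v

/-- `π` is a coupling of `μ` and `ν`. -/
def Coupling {α β : Type*} [MeasurableSpace α] [MeasurableSpace β]
    (γ : Measure (α × β)) (μ : Measure α) (ν : Measure β) : Prop :=
  γ.map Prod.fst = μ ∧ γ.map Prod.snd = ν

/-- Wasserstein-2 distance between measures on `ℝ^N` (Euclidean cost). -/
def W2 {N : ℕ} (μ ν : Measure (V N)) : ℝ :=
  sInf {c | ∃ γ : Measure (V N × V N), Coupling γ μ ν ∧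
    c = Real.sqrt (∫ p, ∑ i, (p.1 i - p.2 i) ^ 2 ∂γ)}

/-- Wasserstein-2 distance between measures on `ℝ`. -/
def W2r (μ ν : Measure ℝ) : ℝ :=
  sInf {c | ∃ γ : Measure (ℝ × ℝ), Coupling γ μ ν ∧
    c = Real.sqrt (∫ p, (p.1 - p.2) ^ 2 ∂γ)}

/-- The measure on `ℝ^N` with density `F`. -/
def densMeasure {N : ℕ} (F : V N → ℝ) : Measure (V N) :=
  volume.withDensity fun v => ENNReal.ofReal (F v)

/-- The measure on `ℝ` with density `f`. -/
def densMeasure1 (f : ℝ → ℝ) : Measure ℝ :=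
  volume.withDensity fun x => ENNReal.ofReal (f x)

/-- The rotation by `θ` in the plane spanned by the `j`-th velocity of the system and the velocity
of a reservoir particle. -/
def reservoirRotation {N : ℕ} (j : Fin N) (θ : ℝ) (p : V N × ℝ) : V N × ℝ :=
  (Function.update p.1 j (p.1 j * Real.cos θ + p.2 * Real.sin θ),
    p.2 * Real.cos θ - p.1 j * Real.sin θ)

theorem continuous_reservoirRotation {N : ℕ} (j : Fin N) :
    Continuous fun q : ℝ × (V N × ℝ) => reservoirRotation j q.1 q.2 := by
  unfold reservoirRotation
  fun_prop

/-- The shear adding a multiple of the reservoir velocity to the `j`-th velocity preserves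
Lebesgue measure. -/
theorem measurePreserving_shear_fst {N : ℕ} (j : Fin N) (a : ℝ) :
    MeasurePreserving (fun p : V N × ℝ => (p.1 + Pi.single j (a * p.2), p.2)) := by
  have h : MeasurePreserving
      (fun p : ℝ × V N => (p.1, p.2 + Pi.single j (a * p.1))) := by
    refine (MeasurePreserving.id volume).skew_product (μc := volume) (μd := volume)
      (g := fun w (v : V N) => v + Pi.single j (a * w)) ?_ ?_
    · refine Continuous.measurable ?_
      simp only [Function.uncurry_def]
      exact continuous_snd.add ((continuous_single j).comp (by fun_prop))
    · exact .of_forall fun w => (measurePreserving_add_right volume _).map_eq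
  exact Measure.measurePreserving_swap.comp (h.comp Measure.measurePreserving_swap)

/-- The shear adding a multiple of the `j`-th velocity to the reservoir velocity preserves
Lebesgue measure. -/
theorem measurePreserving_shear_snd {N : ℕ} (j : Fin N) (b : ℝ) :
    MeasurePreserving (fun p : V N × ℝ => (p.1, p.2 + b * p.1 j)) := by
  refine (MeasurePreserving.id (volume : Measure (V N))).skew_product
    (g := fun v w => w + b * v j) ?_ ?_
  · refine Continuous.measurable ?_
    simp only [Function.uncurry_def]
    fun_prop
  · exact .of_forall fun v => (measurePreserving_add_right volume _).map_eq

theorem reservoirRotation_add {N : ℕ} (j : Fin N) (α β : ℝ) :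
    reservoirRotation j (α + β) = reservoirRotation j α ∘ reservoirRotation j β := by
  funext p
  simp only [reservoirRotation, Function.comp_apply, Function.update_self, Function.update_idem,
    Real.cos_add, Real.sin_add]
  exact Prod.ext (congrArg (Function.update p.1 j) (by ring)) (by ring)

theorem measurePreserving_reservoirRotation_of_cos_ne {N : ℕ} (j : Fin N) {θ : ℝ}
    (hθ : Real.cos θ ≠ -1) : MeasurePreserving (reservoirRotation j θ) := by
  have hc : 1 + Real.cos θ ≠ 0 := fun h => hθ (by linarith)
  obtain ⟨a, ha⟩ : ∃ a, a * (1 + Real.cos θ) = Real.sin θ := ⟨_, div_mul_cancel₀ _ hc⟩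
  have has : a * Real.sin θ = 1 - Real.cos θ := by
    apply mul_right_cancel₀ hc
    linear_combination Real.sin θ * ha + Real.sin_sq_add_cos_sq θ
  convert (measurePreserving_shear_fst j a).comp
    ((measurePreserving_shear_snd j (-Real.sin θ)).comp (measurePreserving_shear_fst j a)) using 1
  funext p
  refine Prod.ext (funext fun i => ?_) ?_
  · rcases eq_or_ne i j with rfl | hij
    · simp only [reservoirRotation, Function.comp_apply, Function.update_self, Pi.add_apply,
        Pi.single_eq_same]
      linear_combination (p.1 i + a * p.2) * has - p.2 * ha
    · simp [reservoirRotation, hij]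
  · simp only [reservoirRotation, Function.comp_apply, Pi.add_apply, Pi.single_eq_same]
    linear_combination p.2 * has

theorem measurePreserving_reservoirRotation {N : ℕ} (j : Fin N) (θ : ℝ) :
    MeasurePreserving (reservoirRotation j θ) := by
  by_cases hθ : Real.cos θ = -1
  · have hcos : Real.cos (θ / 2) ≠ -1 := by
      intro h
      have := Real.cos_sq (θ / 2)
      rw [mul_div_cancel₀ θ two_ne_zero, h, hθ] at this
      norm_num at this
    have h := measurePreserving_reservoirRotation_of_cos_ne j hcos
    rw [← add_halves θ, reservoirRotation_add]
    exact h.comp h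
  · exact measurePreserving_reservoirRotation_of_cos_ne j hθ

/-- The phase `v · ξ` in terms of the rotated velocities. -/
theorem sum_mul_eq_reservoirRotation {N : ℕ} (j : Fin N) (θ : ℝ) (ξ : V N) (p : V N × ℝ) :
    ∑ i, p.1 i * ξ i =
      ∑ i, (reservoirRotation j θ p).1 i * Function.update ξ j (ξ j * Real.cos θ) i +
        (reservoirRotation j θ p).2 * (ξ j * -Real.sin θ) := by
  rw [← Finset.add_sum_erase _ _ (Finset.mem_univ j),
    ← Finset.add_sum_erase (a := j) univ
      (fun i => (reservoirRotation j θ p).1 i * Function.update ξ j (ξ j * Real.cos θ) i)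
      (Finset.mem_univ j)]
  have hsum : ∑ i ∈ univ.erase j, (reservoirRotation j θ p).1 i *
      Function.update ξ j (ξ j * Real.cos θ) i = ∑ i ∈ univ.erase j, p.1 i * ξ i :=
    Finset.sum_congr rfl fun i hi => by simp [reservoirRotation, Finset.ne_of_mem_erase hi]
  rw [hsum]
  simp only [reservoirRotation, Function.update_self]
  linear_combination -p.1 j * ξ j * Real.sin_sq_add_cos_sq θ

/-- The product density after the rotation by `θ`, weighted by the phase `exp (-i v · ξ)`. -/
def rotatedFourierIntegrand {N : ℕ} (g : ℝ → ℝ) (F : V N → ℝ) (j : Fin N) (ξ : V N)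
    (θ : ℝ) (p : V N × ℝ) : ℂ :=
  ((F (reservoirRotation j θ p).1 * g (reservoirRotation j θ p).2 : ℝ) : ℂ) *
    Complex.exp (-Complex.I * ((∑ i, p.1 i * ξ i : ℝ) : ℂ))

theorem integrable_rotatedFourierIntegrand {N : ℕ} {g : ℝ → ℝ} {F : V N → ℝ}
    (hg : Integrable g) (hF : Integrable F) (j : Fin N) (ξ : V N)
    (μ : Measure ℝ) [IsFiniteMeasure μ] :
    Integrable (Function.uncurry (rotatedFourierIntegrand g F j ξ)) (μ.prod volume) := by
  have hT : MeasurePreserving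
      (fun q : ℝ × (V N × ℝ) => (q.1, reservoirRotation j q.1 q.2))
      (μ.prod volume) (μ.prod volume) :=
    (MeasurePreserving.id μ).skew_product (g := reservoirRotation j)
      (continuous_reservoirRotation j).measurable
      (.of_forall fun θ => (measurePreserving_reservoirRotation j θ).map_eq)
  have hK := hT.integrable_comp_of_integrable ((hF.mul_prod hg).comp_snd μ)
  refine hK.ofReal.mul_bdd (c := 1) ?_ (.of_forall fun q => ?_)
  · exact Continuous.aestronglyMeasurable (by fun_prop)
  · rw [neg_mul, mul_comm, ← neg_mul, ← Complex.ofReal_neg, Complex.norm_exp_ofReal_mul_I]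

theorem integral_rotatedFourierIntegrand {N : ℕ} {g : ℝ → ℝ} {F : V N → ℝ}
    (hg : Integrable g) (hF : Integrable F) (j : Fin N) (ξ : V N) (θ : ℝ) :
    ∫ p, rotatedFourierIntegrand g F j ξ θ p =
      ft F (Function.update ξ j (ξ j * Real.cos θ)) * ft1 g (ξ j * -Real.sin θ) := by
  have hρ := measurePreserving_reservoirRotation j θ
  unfold ft ft1
  have hmeas : AEStronglyMeasurable (fun q : V N × ℝ =>
      ((F q.1 : ℂ) * Complex.exp (-Complex.I *
        ((∑ i, q.1 i * Function.update ξ j (ξ j * Real.cos θ) i : ℝ) : ℂ))) *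
      ((g q.2 : ℂ) * Complex.exp (-Complex.I * ((q.2 * (ξ j * -Real.sin θ) : ℝ) : ℂ)))) :=
    (hF.ofReal.aestronglyMeasurable.comp_fst.mul
      (Continuous.aestronglyMeasurable (by fun_prop))).mul
    (hg.ofReal.aestronglyMeasurable.comp_snd.mul
      (Continuous.aestronglyMeasurable (by fun_prop)))
  rw [← integral_prod_mul, ← Measure.volume_eq_prod]
  conv_rhs => rw [← hρ.map_eq]
  rw [integral_map hρ.measurable.aemeasurable (hρ.map_eq.symm ▸ hmeas)]
  refine integral_congr_ae (.of_forall fun p => ?_)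
  simp only [rotatedFourierIntegrand]
  rw [sum_mul_eq_reservoirRotation j θ ξ p, Complex.ofReal_add, mul_add, Complex.exp_add,
    Complex.ofReal_mul]
  ring

/-- The Fourier transform of `R_j[F]` as an iterated integral. -/
theorem ft_ROp_eq_iterated {N : ℕ} (g : ℝ → ℝ) (F : V N → ℝ) (j : Fin N) (ξ : V N) :
    ft (ROp g j F) ξ = (((2 * π)⁻¹ : ℝ) : ℂ) *
      ∫ v : V N, ∫ w : ℝ, ∫ θ in Set.Ioc 0 (2 * π), rotatedFourierIntegrand g F j ξ θ (v, w) := by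
  unfold ft ROp
  rw [← integral_const_mul]
  refine integral_congr_ae (.of_forall fun v => ?_)
  simp only [rotatedFourierIntegrand, reservoirRotation, integral_mul_const,
    integral_complex_ofReal, integral_const_mul,
    intervalIntegral.integral_of_le Real.two_pi_pos.le, mul_comm (g _)]
  rw [Complex.ofReal_mul, mul_assoc]

theorem statement_12 (N : ℕ) (hN : 2 ≤ N)
    (g : ℝ → ℝ) (hg : IsProbDensity1 g)
    (hg1 : Integrable (fun x => x * g x)) (hgmean : ∫ x, x * g x = 0)
    (hg2 : Integrable (fun x => x ^ 2 * g x))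
    (F : V N → ℝ) (hF : IsProbDensity F) (j : Fin N) (ξ : V N) :
    ft (ROp g j F) ξ =
      (((2 * π)⁻¹ : ℝ) : ℂ) * ∫ θ in (0:ℝ)..(2 * π),
        ft F (Function.update ξ j (ξ j * Real.cos θ)) * ft1 g (ξ j * Real.sin θ) := by
  have hint := integrable_rotatedFourierIntegrand hg.2.1 hF.2.1 j ξ
    (volume.restrict (Set.Ioc 0 (2 * π)))
  rw [ft_ROp_eq_iterated, integral_integral hint.swap.integral_prod_left,
    ← Measure.volume_eq_prod, ← integral_integral_swap hint]
  simp only [integral_rotatedFourierIntegrand hg.2.1 hF.2.1]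
  rw [← intervalIntegral.integral_of_le Real.two_pi_pos.le]
  have hreflect := intervalIntegral.integral_comp_sub_left (a := 0) (b := 2 * π)
    (fun θ => ft F (Function.update ξ j (ξ j * Real.cos θ)) * ft1 g (ξ j * Real.sin θ)) (2 * π)
  simp only [Real.cos_two_pi_sub, Real.sin_two_pi_sub, sub_self, sub_zero] at hreflect
  rw [hreflect]

end
end

section
/- For any probability densities F_N, H_N on ℝ^N with zero mean and finite second moments, d_{GTW,N}(Φ[F_N], Φ[H_N]) ≤ (1 − (1−γ)/(2N)) d_{GTW,N}(F_N, H_N); in particular Φ is a strict contraction in the Gabetta–Toscani–Wennberg metric. -/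
open MeasureTheory Real Finset

noncomputable section

/-- A linear map reversed by a linear involution has determinant `±1`, hence preserves Haar
measures. -/
lemma measurePreserving_of_reversible {E : Type*} [NormedAddCommGroup E] [NormedSpace ℝ E]
    [MeasurableSpace E] [BorelSpace E] [FiniteDimensional ℝ E] (μ : Measure E)
    [μ.IsAddHaarMeasure] (L S : E →ₗ[ℝ] E) (hS : ∀ x, S (S x) = x)
    (hL : ∀ x, L (S (L (S x))) = x) : MeasurePreserving L μ μ := by
  have hS' : LinearMap.det S * LinearMap.det S = 1 := by
    rw [← LinearMap.det_comp, show S ∘ₗ S = LinearMap.id from LinearMap.ext hS,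
      LinearMap.det_id]
  have hL' : LinearMap.det L * (LinearMap.det S * (LinearMap.det L * LinearMap.det S)) = 1 := by
    rw [← LinearMap.det_comp, ← LinearMap.det_comp, ← LinearMap.det_comp,
      show L ∘ₗ S ∘ₗ L ∘ₗ S = LinearMap.id from LinearMap.ext hL, LinearMap.det_id]
  have hsq : LinearMap.det L * LinearMap.det L = 1 := by
    linear_combination hL' - LinearMap.det L * LinearMap.det L * hS'
  have habs : |LinearMap.det L| = 1 := by
    rcases mul_self_eq_one_iff.mp hsq with h | h <;> simp [h]
  have hne : LinearMap.det L ≠ 0 := fun h => by simp [h] at hsq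
  refine ⟨L.continuous_of_finiteDimensional.measurable, ?_⟩
  rw [Measure.map_linearMap_addHaar_eq_smul_addHaar μ hne, abs_inv, habs]
  simp

/-- The average of `G` along the curves `θ ↦ T θ x`, `θ ∈ [0, 2π]`. -/
def angleAverage {X : Type*} (T : ℝ → X → X) (G : X → ℝ) (x : X) : ℝ :=
  (2 * π)⁻¹ * ∫ θ in (0:ℝ)..(2 * π), G (T θ x)

section AngleAverage

variable {X : Type*} [MeasureSpace X] [SFinite (volume : Measure X)] {T : ℝ → X → X}

lemma integrable_comp_angle (hT : Measurable (Function.uncurry T))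
    (hmp : ∀ θ, MeasurePreserving (T θ)) {G : X → ℝ} (hG : Integrable G) :
    Integrable (fun p : ℝ × X => G (T p.1 p.2))
      ((volume.restrict (Set.Ioc 0 (2 * π))).prod volume) := by
  have h1 : MeasurePreserving (fun p : ℝ × X => (p.1, T p.1 p.2))
      ((volume.restrict (Set.Ioc 0 (2 * π))).prod volume)
      ((volume.restrict (Set.Ioc 0 (2 * π))).prod volume) :=
    (MeasurePreserving.id _).skew_product hT (Filter.Eventually.of_forall fun θ => (hmp θ).map_eq)
  exact h1.integrable_comp_of_integrable (hG.comp_snd _)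

lemma integrable_angleAverage (hT : Measurable (Function.uncurry T))
    (hmp : ∀ θ, MeasurePreserving (T θ)) {G : X → ℝ} (hG : Integrable G) :
    Integrable (angleAverage T G) := by
  unfold angleAverage
  simp_rw [intervalIntegral.integral_of_le two_pi_pos.le]
  exact (integrable_comp_angle hT hmp hG).integral_prod_right.const_mul _

/-- Testing an angle average against `χ` amounts to averaging the tests of `G` against the
transported functions `χ' θ`. -/
lemma integral_angleAverage_mul (hT : Measurable (Function.uncurry T))
    (hmp : ∀ θ, MeasurePreserving (T θ)) {χ : X → ℂ} {χ' : ℝ → X → ℂ} (hχ : Measurable χ)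
    (hχ1 : ∀ x, ‖χ x‖ ≤ 1) (hχ' : ∀ θ, Measurable (χ' θ)) (h : ∀ θ x, χ x = χ' θ (T θ x))
    {G : X → ℝ} (hG : Integrable G) :
    IntervalIntegrable (fun θ => ∫ y, (G y : ℂ) * χ' θ y) volume 0 (2 * π) ∧
      ∫ x, (angleAverage T G x : ℂ) * χ x =
        ((2 * π)⁻¹ : ℝ) * ∫ θ in (0:ℝ)..(2 * π), ∫ y, (G y : ℂ) * χ' θ y := by
  have key : ∀ θ, ∫ y, (G y : ℂ) * χ' θ y = ∫ x, (G (T θ x) : ℂ) * χ x := by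
    intro θ
    have hsm : AEStronglyMeasurable (fun y => (G y : ℂ) * χ' θ y) (Measure.map (T θ) volume) := by
      rw [(hmp θ).map_eq]
      exact hG.ofReal.aestronglyMeasurable.mul (hχ' θ).aestronglyMeasurable
    rw [← (hmp θ).map_eq, integral_map (hmp θ).aemeasurable hsm, (hmp θ).map_eq]
    simp_rw [← h]
  have hint : Integrable (fun p : ℝ × X => (G (T p.1 p.2) : ℂ) * χ p.2)
      ((volume.restrict (Set.Ioc 0 (2 * π))).prod volume) :=
    (integrable_comp_angle hT hmp hG).ofReal.mul_bdd (c := 1)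
      (hχ.comp measurable_snd).aestronglyMeasurable
      (Filter.Eventually.of_forall fun p => hχ1 p.2)
  simp_rw [key]
  refine ⟨?_, ?_⟩
  · rw [intervalIntegrable_iff_integrableOn_Ioc_of_le two_pi_pos.le]
    exact hint.integral_prod_left
  · unfold angleAverage
    simp_rw [intervalIntegral.integral_of_le two_pi_pos.le]
    rw [integral_integral_swap hint, ← integral_const_mul]
    congr 1 with x
    rw [integral_mul_const, integral_complex_ofReal, Complex.ofReal_mul, mul_assoc]

lemma norm_integral_angleAverage_sub_le (hT : Measurable (Function.uncurry T))
    (hmp : ∀ θ, MeasurePreserving (T θ)) {χ : X → ℂ} {χ' : ℝ → X → ℂ} (hχ : Measurable χ)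
    (hχ1 : ∀ x, ‖χ x‖ ≤ 1) (hχ' : ∀ θ, Measurable (χ' θ)) (h : ∀ θ x, χ x = χ' θ (T θ x))
    {G₁ G₂ : X → ℝ} (hG₁ : Integrable G₁) (hG₂ : Integrable G₂) {B : ℝ → ℝ} (hB : Continuous B)
    (hle : ∀ θ, ‖(∫ y, (G₁ y : ℂ) * χ' θ y) - ∫ y, (G₂ y : ℂ) * χ' θ y‖ ≤ B θ) :
    ‖(∫ x, (angleAverage T G₁ x : ℂ) * χ x) - ∫ x, (angleAverage T G₂ x : ℂ) * χ x‖ ≤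
      (2 * π)⁻¹ * ∫ θ in (0:ℝ)..(2 * π), B θ := by
  obtain ⟨i₁, e₁⟩ := integral_angleAverage_mul hT hmp hχ hχ1 hχ' h hG₁
  obtain ⟨i₂, e₂⟩ := integral_angleAverage_mul hT hmp hχ hχ1 hχ' h hG₂
  rw [e₁, e₂, ← mul_sub, ← intervalIntegral.integral_sub i₁ i₂, norm_mul, Complex.norm_real,
    Real.norm_of_nonneg (by positivity)]
  gcongr
  exact intervalIntegral.norm_integral_le_of_norm_le two_pi_pos.le
    (Filter.Eventually.of_forall fun θ _ => hle θ) (hB.intervalIntegrable _ _)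

end AngleAverage

section Character

variable {N : ℕ}

/-- The character `v ↦ e^{-i v·ξ}`. -/
def character (ξ v : V N) : ℂ := Complex.exp (-Complex.I * ((∑ i, v i * ξ i : ℝ) : ℂ))

lemma norm_exp_neg_I_mul (x : ℝ) : ‖Complex.exp (-Complex.I * (x : ℂ))‖ = 1 := by
  simp [Complex.norm_exp]

lemma norm_character (ξ v : V N) : ‖character ξ v‖ = 1 := norm_exp_neg_I_mul _

lemma measurable_character (ξ : V N) : Measurable (character ξ) := by
  unfold character
  exact Continuous.measurable (by fun_prop)

lemma integrable_mul_character {f : V N → ℝ} (hf : Integrable f) (ξ : V N) :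
    Integrable fun v => (f v : ℂ) * character ξ v :=
  hf.ofReal.mul_bdd (c := 1) (measurable_character ξ).aestronglyMeasurable
    (Filter.Eventually.of_forall fun v => (norm_character ξ v).le)

lemma ft_zero (f : V N → ℝ) : ft f 0 = ((∫ v, f v : ℝ) : ℂ) := by
  simp [ft, integral_complex_ofReal]

lemma ft_eq_integral_character (f : V N → ℝ) (ξ : V N) :
    ft f ξ = ∫ v, (f v : ℂ) * character ξ v := rfl

lemma ft_const_mul (c : ℝ) (f : V N → ℝ) (ξ : V N) : ft (fun v => c * f v) ξ = c * ft f ξ := by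
  unfold ft
  rw [← integral_const_mul]
  simp [mul_assoc]

lemma ft_add {f h : V N → ℝ} (hf : Integrable f) (hh : Integrable h) (ξ : V N) :
    ft (fun v => f v + h v) ξ = ft f ξ + ft h ξ := by
  simp only [ft_eq_integral_character]
  rw [← integral_add (integrable_mul_character hf ξ) (integrable_mul_character hh ξ)]
  simp [add_mul]

lemma ft_sum {ι : Type*} (s : Finset ι) {f : ι → V N → ℝ} (hf : ∀ i ∈ s, Integrable (f i))
    (ξ : V N) : ft (fun v => ∑ i ∈ s, f i v) ξ = ∑ i ∈ s, ft (f i) ξ := by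
  simp only [ft_eq_integral_character]
  rw [← integral_finsetSum s fun i hi => integrable_mul_character (hf i hi) ξ]
  simp [Finset.sum_mul]

lemma norm_ft1_le_one {g : ℝ → ℝ} (hg : IsProbDensity1 g) (x : ℝ) : ‖ft1 g x‖ ≤ 1 := by
  calc ‖ft1 g x‖ ≤ ∫ v, ‖(g v : ℂ) * Complex.exp (-Complex.I * ((v * x : ℝ) : ℂ))‖ :=
        norm_integral_le_integral_norm _
    _ = ∫ v, g v := by
        congr 1 with v
        rw [norm_mul, norm_exp_neg_I_mul, Complex.norm_real, Real.norm_of_nonneg (hg.1 v), mul_one]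
    _ = 1 := hg.2.2

end Character

section Distance

variable {N : ℕ}

lemma norm_exp_neg_I_mul_sub_le (x : ℝ) :
    ‖Complex.exp (-Complex.I * (x : ℂ)) - 1 - (-Complex.I * (x : ℂ))‖ ≤ 3 * x ^ 2 := by
  have hx : ‖-Complex.I * (x : ℂ)‖ = |x| := by simp
  rcases le_total |x| 1 with h | h
  · have := Complex.norm_exp_sub_one_sub_id_le (hx.trans_le h)
    rw [hx, sq_abs] at this
    nlinarith [sq_nonneg x]
  · have h1 := norm_sub_le (Complex.exp (-Complex.I * (x : ℂ)) - 1) (-Complex.I * (x : ℂ))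
    have h2 := norm_sub_le (Complex.exp (-Complex.I * (x : ℂ))) 1
    rw [norm_exp_neg_I_mul, norm_one] at h2
    rw [hx] at h1
    nlinarith [sq_abs x]

lemma sum_sq_pos {ξ : V N} (hξ : ξ ≠ 0) : 0 < ∑ i, ξ i ^ 2 := by
  obtain ⟨i, hi⟩ := Function.ne_iff.mp hξ
  exact Finset.sum_pos' (fun i _ => sq_nonneg _) ⟨i, Finset.mem_univ i, by
    have : ξ i ≠ 0 := hi
    positivity⟩

/-- A centred density with finite second moments has a Fourier transform equal to `1` up to a
quadratic error. -/
lemma norm_ft_sub_one_le {F : V N → ℝ} (hF : IsProbDensity F)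
    (hmean : ∀ k : Fin N, ∫ v : V N, v k * F v = 0)
    (hF2 : Integrable (fun v : V N => (∑ i, v i ^ 2) * F v)) (ξ : V N) :
    ‖ft F ξ - 1‖ ≤ (3 * ∫ v : V N, (∑ i, v i ^ 2) * F v) * ∑ i, ξ i ^ 2 := by
  have hk : ∀ k, Integrable fun v : V N => v k * F v := by
    intro k
    refine (hF.2.1.add hF2).mono'
      ((measurable_pi_apply k).aestronglyMeasurable.mul hF.2.1.aestronglyMeasurable)
      (Filter.Eventually.of_forall fun v => ?_)
    have h0 := hF.1 v
    have h1 : v k ^ 2 ≤ ∑ i, v i ^ 2 :=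
      Finset.single_le_sum (f := fun i => v i ^ 2) (fun i _ => sq_nonneg _) (Finset.mem_univ k)
    have h2 : |v k| ≤ 1 + ∑ i, v i ^ 2 := by
      nlinarith [sq_nonneg (|v k| - 1), sq_abs (v k), abs_nonneg (v k)]
    rw [norm_mul, Real.norm_eq_abs, Real.norm_of_nonneg h0, Pi.add_apply]
    nlinarith [mul_le_mul_of_nonneg_right h2 h0]
  have hdot : Integrable fun v : V N => F v * ∑ i, v i * ξ i := by
    have : Integrable fun v : V N => ∑ i, ξ i * (v i * F v) :=
      integrable_finsetSum _ fun i _ => (hk i).const_mul _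
    refine this.congr (Filter.Eventually.of_forall fun v => ?_)
    simp only [Finset.mul_sum]
    exact Finset.sum_congr rfl fun i _ => by ring
  have hdot0 : ∫ v : V N, F v * ∑ i, v i * ξ i = 0 := by
    have h1 : ∀ v : V N, F v * ∑ i, v i * ξ i = ∑ i, ξ i * (v i * F v) := fun v => by
      rw [Finset.mul_sum]
      exact Finset.sum_congr rfl fun i _ => by ring
    simp_rw [h1]
    rw [integral_finsetSum _ fun i _ => (hk i).const_mul _]
    simp [integral_const_mul, hmean]
  have hrep : ft F ξ - 1 = ∫ v : V N, (F v : ℂ) *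
      (Complex.exp (-Complex.I * ((∑ i, v i * ξ i : ℝ) : ℂ)) - 1
        - (-Complex.I * ((∑ i, v i * ξ i : ℝ) : ℂ))) := by
    have e1 : ∀ v : V N, (F v : ℂ) *
      (Complex.exp (-Complex.I * ((∑ i, v i * ξ i : ℝ) : ℂ)) - 1
        - (-Complex.I * ((∑ i, v i * ξ i : ℝ) : ℂ))) =
        (F v : ℂ) * character ξ v - (F v : ℂ)
          + Complex.I * ((F v * ∑ i, v i * ξ i : ℝ) : ℂ) := fun v => by
      rw [character, Complex.ofReal_mul]
      ring
    simp_rw [e1]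
    have hFc : Integrable fun v : V N => (F v : ℂ) := hF.2.1.ofReal
    have hsub : Integrable fun v : V N => (F v : ℂ) * character ξ v - (F v : ℂ) :=
      (integrable_mul_character hF.2.1 ξ).sub hFc
    have hdotI : Integrable fun v : V N => Complex.I * ((F v * ∑ i, v i * ξ i : ℝ) : ℂ) :=
      hdot.ofReal.const_mul _
    rw [integral_add hsub hdotI, integral_sub (integrable_mul_character hF.2.1 ξ) hFc,
      integral_const_mul, integral_complex_ofReal, integral_complex_ofReal, hdot0, hF.2.2]
    simp [ft, character]
  rw [hrep]
  calc _ ≤ ∫ v : V N, 3 * (∑ i, ξ i ^ 2) * ((∑ i, v i ^ 2) * F v) := by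
        refine norm_integral_le_of_norm_le (hF2.const_mul _)
          (Filter.Eventually.of_forall fun v => ?_)
        have h0 := hF.1 v
        rw [norm_mul, Complex.norm_real, Real.norm_of_nonneg h0]
        have h1 := norm_exp_neg_I_mul_sub_le (∑ i, v i * ξ i)
        have h2 := Finset.sum_mul_sq_le_sq_mul_sq Finset.univ v ξ
        calc _ ≤ F v * (3 * ((∑ i, v i ^ 2) * ∑ i, ξ i ^ 2)) := by
              gcongr
              linarith
          _ = _ := by ring
    _ = _ := by
        rw [integral_const_mul]
        ring

lemma dGTW_nonneg (f h : V N → ℝ) : 0 ≤ dGTW f h :=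
  Real.iSup_nonneg fun ξ => by positivity

lemma norm_ft_sub_le_dGTW_mul {F H : V N → ℝ} (hF : IsProbDensity F) (hH : IsProbDensity H)
    (hFmean : ∀ k : Fin N, ∫ v : V N, v k * F v = 0)
    (hHmean : ∀ k : Fin N, ∫ v : V N, v k * H v = 0)
    (hF2 : Integrable (fun v : V N => (∑ i, v i ^ 2) * F v))
    (hH2 : Integrable (fun v : V N => (∑ i, v i ^ 2) * H v)) (ξ : V N) :
    ‖ft F ξ - ft H ξ‖ ≤ dGTW F H * ∑ i, ξ i ^ 2 := by
  rcases eq_or_ne ξ 0 with rfl | hξ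
  · simp [ft_zero, hF.2.2, hH.2.2]
  rw [← div_le_iff₀ (sum_sq_pos hξ)]
  refine le_ciSup (f := fun ξ : {ξ : V N // ξ ≠ 0} =>
    ‖ft F ξ.1 - ft H ξ.1‖ / (∑ i, (ξ.1 i) ^ 2)) ?_ ⟨ξ, hξ⟩
  refine ⟨(3 * ∫ v : V N, (∑ i, v i ^ 2) * F v) + (3 * ∫ v : V N, (∑ i, v i ^ 2) * H v), ?_⟩
  rintro _ ⟨η, rfl⟩
  simp only
  rw [div_le_iff₀ (sum_sq_pos η.2)]
  have h1 := norm_ft_sub_one_le hF hFmean hF2 η.1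
  have h2 := norm_ft_sub_one_le hH hHmean hH2 η.1
  have h3 := norm_sub_le (ft F η.1 - 1) (ft H η.1 - 1)
  rw [sub_sub_sub_cancel_right] at h3
  linarith

end Distance

section Collision

variable {N : ℕ}

lemma collide_apply_left {i j : Fin N} (hij : i ≠ j) (v : V N) (θ : ℝ) :
    collide v i j θ i = v i * Real.cos θ + v j * Real.sin θ := by
  simp [collide, hij]

lemma collide_apply_right (i j : Fin N) (v : V N) (θ : ℝ) :
    collide v i j θ j = -(v i) * Real.sin θ + v j * Real.cos θ := by
  simp [collide]

lemma collide_apply_of_ne {i j k : Fin N} (hi : k ≠ i) (hj : k ≠ j) (v : V N) (θ : ℝ) :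
    collide v i j θ k = v k := by
  simp [collide, hi, hj]

lemma sum_eq_add_add_sum_erase {i j : Fin N} (hij : i ≠ j) (f : Fin N → ℝ) :
    ∑ k, f k = f i + f j + ∑ k ∈ (Finset.univ.erase i).erase j, f k := by
  rw [← Finset.add_sum_erase _ f (Finset.mem_univ i),
    ← Finset.add_sum_erase _ f (Finset.mem_erase.mpr ⟨hij.symm, Finset.mem_univ j⟩), add_assoc]

lemma sum_collide_mul_collide {i j : Fin N} (hij : i ≠ j) (v ξ : V N) (θ : ℝ) :
    ∑ k, collide v i j θ k * collide ξ i j θ k = ∑ k, v k * ξ k := by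
  rw [sum_eq_add_add_sum_erase hij, sum_eq_add_add_sum_erase hij (fun k => v k * ξ k)]
  have hrest : ∀ k ∈ (Finset.univ.erase i).erase j,
      collide v i j θ k * collide ξ i j θ k = v k * ξ k := fun k hk => by
    simp only [Finset.mem_erase, Finset.mem_univ, and_true] at hk
    rw [collide_apply_of_ne hk.2 hk.1, collide_apply_of_ne hk.2 hk.1]
  rw [Finset.sum_congr rfl hrest]
  simp only [collide_apply_left hij, collide_apply_right]
  linear_combination (v i * ξ i + v j * ξ j) * Real.sin_sq_add_cos_sq θ

/-- The collision as a linear map. -/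
def collideLin (i j : Fin N) (θ : ℝ) : V N →ₗ[ℝ] V N where
  toFun v := collide v i j θ
  map_add' v w := by
    ext k
    simp only [collide, Function.update_apply, Pi.add_apply]
    split_ifs <;> ring
  map_smul' c v := by
    ext k
    simp only [collide, Function.update_apply, Pi.smul_apply, smul_eq_mul, RingHom.id_apply]
    split_ifs <;> ring

/-- Reversal of the sign of the coordinate `j`. -/
def flipLin (j : Fin N) : V N →ₗ[ℝ] V N where
  toFun v := Function.update v j (-v j)
  map_add' v w := by
    ext k
    simp only [Function.update_apply, Pi.add_apply]
    split_ifs <;> ring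
  map_smul' c v := by
    ext k
    simp only [Function.update_apply, Pi.smul_apply, smul_eq_mul, RingHom.id_apply]
    split_ifs <;> ring

lemma flipLin_flipLin (j : Fin N) (v : V N) : flipLin j (flipLin j v) = v := by
  simp [flipLin]

lemma measurePreserving_collide {i j : Fin N} (hij : i ≠ j) (θ : ℝ) :
    MeasurePreserving (fun v : V N => collide v i j θ) := by
  refine measurePreserving_of_reversible volume (collideLin i j θ) (flipLin j)
    (flipLin_flipLin j) fun v => ?_
  ext k
  have hs := Real.sin_sq_add_cos_sq θ
  rcases eq_or_ne k i with rfl | hi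
  · simp [collideLin, flipLin, collide, hij]
    linear_combination v k * hs
  rcases eq_or_ne k j with rfl | hj
  · simp [collideLin, flipLin, collide, hij]
    linear_combination v k * hs
  · simp [collideLin, flipLin, collide, hi, hj]

lemma measurable_collide (i j : Fin N) :
    Measurable (Function.uncurry fun (θ : ℝ) (v : V N) => collide v i j θ) := by
  apply Continuous.measurable
  unfold collide Function.uncurry
  fun_prop

lemma norm_ft_collide_sub_le {F H : V N → ℝ} (hF : Integrable F) (hH : Integrable H) {d : ℝ}
    (hd : ∀ ξ, ‖ft F ξ - ft H ξ‖ ≤ d * ∑ i, ξ i ^ 2) {i j : Fin N} (hij : i ≠ j) (ξ : V N) :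
    ‖ft (angleAverage (fun θ v => collide v i j θ) F) ξ
      - ft (angleAverage (fun θ v => collide v i j θ) H) ξ‖ ≤ d * ∑ i, ξ i ^ 2 := by
  have := norm_integral_angleAverage_sub_le (measurable_collide i j)
    (measurePreserving_collide hij) (χ := character ξ)
    (χ' := fun θ => character (collide ξ i j θ)) (measurable_character ξ)
    (fun v => (norm_character ξ v).le) (fun θ => measurable_character _)
    (fun θ v => by simp only [character, sum_collide_mul_collide hij]) hF hH
    (B := fun _ => d * ∑ i, ξ i ^ 2) continuous_const
    (fun θ => by
      refine (hd (collide ξ i j θ)).trans_eq ?_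
      simp only [pow_two, sum_collide_mul_collide hij])
  refine this.trans_eq ?_
  rw [intervalIntegral.integral_const, smul_eq_mul, sub_zero, ← mul_assoc,
    inv_mul_cancel₀ two_pi_pos.ne', one_mul]

end Collision

section Thermostat

variable {N : ℕ}

/-- The rotation of the coordinate `j` with an additional reservoir velocity. -/
def thermostat (j : Fin N) (θ : ℝ) (p : V N × ℝ) : V N × ℝ :=
  (Function.update p.1 j (p.1 j * Real.cos θ + p.2 * Real.sin θ),
    p.2 * Real.cos θ - p.1 j * Real.sin θ)

lemma measurable_thermostat (j : Fin N) : Measurable (Function.uncurry (thermostat j)) := by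
  apply Continuous.measurable
  unfold thermostat Function.uncurry
  fun_prop

/-- The thermostat rotation as a linear map. -/
def thermostatLin (j : Fin N) (θ : ℝ) : V N × ℝ →ₗ[ℝ] V N × ℝ where
  toFun := thermostat j θ
  map_add' p q := by
    ext k
    · simp only [thermostat, Function.update_apply, Prod.fst_add, Prod.snd_add, Pi.add_apply]
      split_ifs <;> ring
    · simp only [thermostat, Prod.fst_add, Prod.snd_add, Pi.add_apply]
      ring
  map_smul' c p := by
    ext k
    · simp only [thermostat, Function.update_apply, Prod.smul_fst, Prod.smul_snd, Pi.smul_apply,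
        smul_eq_mul, RingHom.id_apply]
      split_ifs <;> ring
    · simp only [thermostat, Prod.smul_fst, Prod.smul_snd, Pi.smul_apply, smul_eq_mul,
        RingHom.id_apply]
      ring

lemma measurePreserving_thermostat (j : Fin N) (θ : ℝ) :
    MeasurePreserving (thermostat j θ) := by
  have : (volume : Measure (V N × ℝ)).IsAddHaarMeasure := by
    rw [Measure.volume_eq_prod]
    infer_instance
  refine measurePreserving_of_reversible volume (thermostatLin j θ)
    (LinearMap.prodMap LinearMap.id (-LinearMap.id)) (fun p => by simp) fun p => ?_
  have hs := Real.sin_sq_add_cos_sq θ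
  ext k
  · rcases eq_or_ne k j with rfl | hj
    · simp [thermostatLin, thermostat]
      linear_combination p.1 k * hs
    · simp [thermostatLin, thermostat, hj]
  · simp [thermostatLin, thermostat]
    linear_combination p.2 * hs

lemma sum_update_mul (v ξ : V N) (j : Fin N) (a : ℝ) :
    ∑ k, v k * Function.update ξ j a k = ∑ k, v k * ξ k - v j * ξ j + v j * a := by
  rw [← Finset.add_sum_erase _ _ (Finset.mem_univ j),
    ← Finset.add_sum_erase _ (fun k => v k * ξ k) (Finset.mem_univ j), Function.update_self,
    Finset.sum_congr rfl fun k hk => by rw [Function.update_of_ne (Finset.ne_of_mem_erase hk)]]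
  ring

lemma sum_update_sq (ξ : V N) (j : Fin N) (a : ℝ) :
    ∑ k, Function.update ξ j a k ^ 2 = ∑ k, ξ k ^ 2 - ξ j ^ 2 + a ^ 2 := by
  rw [← Finset.add_sum_erase _ _ (Finset.mem_univ j),
    ← Finset.add_sum_erase _ (fun k => ξ k ^ 2) (Finset.mem_univ j), Function.update_self,
    Finset.sum_congr rfl fun k hk => by rw [Function.update_of_ne (Finset.ne_of_mem_erase hk)]]
  ring

lemma sum_thermostat (v ξ : V N) (w : ℝ) (j : Fin N) (θ : ℝ) :
    ∑ k, (thermostat j θ (v, w)).1 k * Function.update ξ j (ξ j * Real.cos θ) k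
      + (thermostat j θ (v, w)).2 * (-(ξ j * Real.sin θ)) = ∑ k, v k * ξ k := by
  have h1 : ∑ k, (thermostat j θ (v, w)).1 k * ξ k =
      ∑ k, v k * ξ k - v j * ξ j + (v j * Real.cos θ + w * Real.sin θ) * ξ j := by
    simp only [thermostat]
    simp_rw [mul_comm _ (ξ _)]
    exact sum_update_mul ξ v j _
  rw [sum_update_mul, h1]
  simp only [thermostat, Function.update_self]
  linear_combination v j * ξ j * Real.sin_sq_add_cos_sq θ

lemma integrable_density_mul {g : ℝ → ℝ} (hg : Integrable g) {F : V N → ℝ} (hF : Integrable F) :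
    Integrable fun p : V N × ℝ => g p.2 * F p.1 :=
  (hF.mul_prod hg).congr (Filter.Eventually.of_forall fun _ => mul_comm _ _)

lemma integrable_thermostat_average {g : ℝ → ℝ} (hg : Integrable g) {F : V N → ℝ}
    (hF : Integrable F) (j : Fin N) :
    Integrable (angleAverage (thermostat j) fun p => g p.2 * F p.1) :=
  integrable_angleAverage (measurable_thermostat j) (measurePreserving_thermostat j)
    (integrable_density_mul hg hF)

lemma ROp_eq_integral_angleAverage (g : ℝ → ℝ) (j : Fin N) (F : V N → ℝ) :
    ROp g j F = fun v => ∫ w, angleAverage (thermostat j) (fun p => g p.2 * F p.1) (v, w) := rfl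

lemma integrable_ROp {g : ℝ → ℝ} (hg : Integrable g) {F : V N → ℝ} (hF : Integrable F)
    (j : Fin N) : Integrable (ROp g j F) :=
  (integrable_thermostat_average hg hF j).integral_prod_left

lemma ft_ROp {g : ℝ → ℝ} (hg : Integrable g) {F : V N → ℝ} (hF : Integrable F) (j : Fin N)
    (ξ : V N) : ft (ROp g j F) ξ =
      ∫ p : V N × ℝ, (angleAverage (thermostat j) (fun p => g p.2 * F p.1) p : ℂ)
        * character ξ p.1 := by
  have hint : Integrable (fun p : V N × ℝ =>
      (angleAverage (thermostat j) (fun p => g p.2 * F p.1) p : ℂ) * character ξ p.1) :=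
    (integrable_thermostat_average hg hF j).ofReal.mul_bdd (c := 1)
      ((measurable_character ξ).comp measurable_fst).aestronglyMeasurable
      (Filter.Eventually.of_forall fun p => (norm_character ξ p.1).le)
  rw [Measure.volume_eq_prod, integral_prod _ (by rwa [← Measure.volume_eq_prod])]
  rw [ft_eq_integral_character]
  congr 1 with v
  simp only [integral_mul_const, integral_complex_ofReal, ROp_eq_integral_angleAverage]

lemma integral_density_mul_character (g : ℝ → ℝ) (F : V N → ℝ) (η : V N) (a : ℝ) :
    ∫ p : V N × ℝ, ((g p.2 * F p.1 : ℝ) : ℂ)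
      * Complex.exp (-Complex.I * ((∑ k, p.1 k * η k + p.2 * a : ℝ) : ℂ)) =
        ft F η * ft1 g a := by
  unfold ft ft1
  rw [Measure.volume_eq_prod, ← integral_prod_mul]
  congr 1 with p
  rw [Complex.ofReal_add, mul_add, Complex.exp_add, Complex.ofReal_mul]
  ring

lemma norm_ft_ROp_sub_le {g : ℝ → ℝ} (hg : IsProbDensity1 g) {F H : V N → ℝ}
    (hF : Integrable F) (hH : Integrable H) {d : ℝ}
    (hd : ∀ ξ, ‖ft F ξ - ft H ξ‖ ≤ d * ∑ i, ξ i ^ 2) (j : Fin N) (ξ : V N) :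
    ‖ft (ROp g j F) ξ - ft (ROp g j H) ξ‖ ≤ d * (∑ i, ξ i ^ 2 - ξ j ^ 2 / 2) := by
  rw [ft_ROp hg.2.1 hF, ft_ROp hg.2.1 hH]
  refine (norm_integral_angleAverage_sub_le (measurable_thermostat j)
    (measurePreserving_thermostat j) (χ := fun p => character ξ p.1)
    (χ' := fun θ p => Complex.exp (-Complex.I *
      ((∑ k, p.1 k * Function.update ξ j (ξ j * Real.cos θ) k
        + p.2 * (-(ξ j * Real.sin θ)) : ℝ) : ℂ)))
    ((measurable_character ξ).comp measurable_fst)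
    (fun p => (norm_character ξ p.1).le) (fun θ => Continuous.measurable (by fun_prop))
    (fun θ p => by rw [sum_thermostat p.1 ξ p.2 j θ, character])
    (integrable_density_mul hg.2.1 hF) (integrable_density_mul hg.2.1 hH)
    (B := fun θ => d * ∑ i, ξ i ^ 2 - d * ξ j ^ 2 * Real.sin θ ^ 2) (by fun_prop)
    (fun θ => ?_)).trans_eq ?_
  · rw [integral_density_mul_character, integral_density_mul_character, ← sub_mul, norm_mul]
    calc _ ≤ ‖ft F (Function.update ξ j (ξ j * Real.cos θ))
          - ft H (Function.update ξ j (ξ j * Real.cos θ))‖ :=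
          mul_le_of_le_one_right (norm_nonneg _) (norm_ft1_le_one hg _)
      _ ≤ _ := hd _
      _ = _ := by
          rw [sum_update_sq]
          linear_combination d * ξ j ^ 2 * Real.sin_sq_add_cos_sq θ
  · rw [intervalIntegral.integral_sub (by simp) (Continuous.intervalIntegrable (by fun_prop) _ _),
      intervalIntegral.integral_const, intervalIntegral.integral_const_mul, integral_sin_sq]
    simp
    field_simp

end Thermostat

section Contraction

variable {N : ℕ}

lemma sum_ite_lt_eq_choose_two (N : ℕ) (c : ℝ) :
    ∑ i : Fin N, ∑ j : Fin N, (if i < j then c else 0) = (N.choose 2 : ℝ) * c := by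
  have h1 : ∀ i : Fin N, ∑ j : Fin N, (if i < j then c else 0) = ((N - 1 - i : ℕ) : ℝ) * c := by
    intro i
    rw [← Finset.sum_filter, Finset.sum_const, nsmul_eq_mul, Finset.filter_lt_eq_Ioi,
      Fin.card_Ioi]
  simp_rw [h1]
  rw [← Finset.sum_mul, ← Nat.cast_sum, Fin.sum_univ_eq_sum_range (fun i => N - 1 - i) N,
    Finset.sum_range_reflect (fun i => i) N, Finset.sum_range_id, Nat.choose_two_right]

lemma integrable_collision_term {F : V N → ℝ} (hF : Integrable F) (i j : Fin N) :
    Integrable fun v => if i < j then angleAverage (fun θ v => collide v i j θ) F v else 0 := by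
  split_ifs with hij
  · exact integrable_angleAverage (measurable_collide i j) (measurePreserving_collide hij.ne) hF
  · exact integrable_zero _ _ _

lemma QOp_eq_sum_angleAverage (F : V N → ℝ) :
    QOp F = fun v => (N.choose 2 : ℝ)⁻¹ * ∑ i : Fin N, ∑ j : Fin N,
      if i < j then angleAverage (fun θ v => collide v i j θ) F v else 0 := rfl

lemma integrable_QOp {F : V N → ℝ} (hF : Integrable F) : Integrable (QOp F) := by
  rw [QOp_eq_sum_angleAverage]
  exact (integrable_finsetSum _ fun i _ => integrable_finsetSum _ fun j _ =>
    integrable_collision_term hF i j).const_mul _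

lemma ft_QOp {F : V N → ℝ} (hF : Integrable F) (ξ : V N) :
    ft (QOp F) ξ = ((N.choose 2 : ℝ)⁻¹ : ℝ) * ∑ i : Fin N, ∑ j : Fin N,
      ft (fun v => if i < j then angleAverage (fun θ v => collide v i j θ) F v else 0) ξ := by
  rw [QOp_eq_sum_angleAverage, ft_const_mul, ft_sum _ fun i _ =>
    integrable_finsetSum _ fun j _ => integrable_collision_term hF i j]
  congr 2 with i
  exact ft_sum _ (fun j _ => integrable_collision_term hF i j) ξ

lemma norm_ft_QOp_sub_le (hN : 2 ≤ N) {F H : V N → ℝ} (hF : Integrable F) (hH : Integrable H)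
    {d : ℝ} (hd : ∀ ξ, ‖ft F ξ - ft H ξ‖ ≤ d * ∑ i, ξ i ^ 2) (ξ : V N) :
    ‖ft (QOp F) ξ - ft (QOp H) ξ‖ ≤ d * ∑ i, ξ i ^ 2 := by
  have hc : (0 : ℝ) < N.choose 2 := by exact_mod_cast Nat.choose_pos hN
  rw [ft_QOp hF, ft_QOp hH, ← mul_sub, ← Finset.sum_sub_distrib, norm_mul, Complex.norm_real,
    Real.norm_of_nonneg (by positivity), inv_mul_le_iff₀ hc, ← sum_ite_lt_eq_choose_two]
  refine norm_sum_le_of_le _ fun i _ => ?_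
  rw [← Finset.sum_sub_distrib]
  refine norm_sum_le_of_le _ fun j _ => ?_
  split_ifs with hij
  · exact norm_ft_collide_sub_le hF hH hd hij.ne ξ
  · simp

lemma ft_PhiOp (γ : ℝ) {g : ℝ → ℝ} (hg : Integrable g) {F : V N → ℝ} (hF : Integrable F)
    (ξ : V N) : ft (PhiOp γ g F) ξ =
      γ * ft (QOp F) ξ + ((1 - γ) * (N : ℝ)⁻¹ : ℝ) * ∑ j : Fin N, ft (ROp g j F) ξ := by
  have hR := fun j (_ : j ∈ Finset.univ) => integrable_ROp hg hF j
  unfold PhiOp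
  rw [ft_add ((integrable_QOp hF).const_mul _) ((integrable_finsetSum _ hR).const_mul _),
    ft_const_mul, ft_const_mul, ft_sum _ hR]

lemma norm_ft_PhiOp_sub_le (hN : 2 ≤ N) {γ : ℝ} (hγ0 : 0 ≤ γ) (hγ1 : γ ≤ 1) {g : ℝ → ℝ}
    (hg : IsProbDensity1 g) {F H : V N → ℝ} (hF : Integrable F) (hH : Integrable H)
    {d : ℝ} (hd : ∀ ξ, ‖ft F ξ - ft H ξ‖ ≤ d * ∑ i, ξ i ^ 2) (ξ : V N) :
    ‖ft (PhiOp γ g F) ξ - ft (PhiOp γ g H) ξ‖ ≤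
      (1 - (1 - γ) / (2 * N)) * d * ∑ i, ξ i ^ 2 := by
  have hN0 : (0 : ℝ) < N := by exact_mod_cast (by omega : 0 < N)
  have hγ2 : 0 ≤ 1 - γ := sub_nonneg.mpr hγ1
  have hsum : ‖∑ j : Fin N, (ft (ROp g j F) ξ - ft (ROp g j H) ξ)‖ ≤
      ∑ j : Fin N, d * (∑ i, ξ i ^ 2 - ξ j ^ 2 / 2) :=
    norm_sum_le_of_le _ fun j _ => norm_ft_ROp_sub_le hg hF hH hd j ξ
  rw [ft_PhiOp γ hg.2.1 hF, ft_PhiOp γ hg.2.1 hH, add_sub_add_comm, ← mul_sub, ← mul_sub,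
    ← Finset.sum_sub_distrib]
  calc _ ≤ γ * (d * ∑ i, ξ i ^ 2)
        + (1 - γ) * (N : ℝ)⁻¹ * ∑ j : Fin N, d * (∑ i, ξ i ^ 2 - ξ j ^ 2 / 2) := by
        refine norm_add_le_of_le ?_ ?_ <;> rw [norm_mul, Complex.norm_real, Real.norm_of_nonneg]
        · exact mul_le_mul_of_nonneg_left (norm_ft_QOp_sub_le hN hF hH hd ξ) hγ0
        · exact hγ0
        · exact mul_le_mul_of_nonneg_left hsum (by positivity)
        · positivity
    _ = _ := by
        rw [← Finset.mul_sum, Finset.sum_sub_distrib, ← Finset.sum_div, Finset.sum_const,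
          Finset.card_univ, Fintype.card_fin, nsmul_eq_mul]
        field_simp
        ring

end Contraction

theorem statement_13 (N : ℕ) (hN : 2 ≤ N) (lam mu : ℝ) (hlam : 0 < lam) (hmu : 0 < mu)
    (g : ℝ → ℝ) (hg : IsProbDensity1 g)
    (hg1 : Integrable (fun x => x * g x)) (hgmean : ∫ x, x * g x = 0)
    (hg2 : Integrable (fun x => x ^ 2 * g x))
    (F H : V N → ℝ) (hF : IsProbDensity F) (hH : IsProbDensity H)
    (hFmean : ∀ k : Fin N, ∫ v : V N, v k * F v = 0)
    (hHmean : ∀ k : Fin N, ∫ v : V N, v k * H v = 0)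
    (hF2 : Integrable (fun v : V N => (∑ i, v i ^ 2) * F v))
    (hH2 : Integrable (fun v : V N => (∑ i, v i ^ 2) * H v)) :
    dGTW (PhiOp (lam / (lam + mu)) g F) (PhiOp (lam / (lam + mu)) g H) ≤
      (1 - (1 - lam / (lam + mu)) / (2 * N)) * dGTW F H := by
  have hd := norm_ft_sub_le_dGTW_mul hF hH hFmean hHmean hF2 hH2
  have hγ0 : 0 ≤ lam / (lam + mu) := by positivity
  have hγ1 : lam / (lam + mu) ≤ 1 := (div_le_one (by positivity)).mpr (by linarith)
  have hN1 : (1 : ℝ) ≤ 2 * N := by exact_mod_cast (by omega : 1 ≤ 2 * N)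
  have hc : 0 ≤ 1 - (1 - lam / (lam + mu)) / (2 * N) := by
    rw [sub_nonneg, div_le_one (by positivity)]
    linarith
  refine Real.iSup_le (fun ξ => ?_) (mul_nonneg hc (dGTW_nonneg F H))
  rw [div_le_iff₀ (sum_sq_pos ξ.2)]
  exact norm_ft_PhiOp_sub_le hN hγ0 hγ1 hg hF.2.1 hH.2.1 hd ξ.1

end
end
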